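/- arXiv:2108.03088 — 3 statements merged into one kernel-verified Lean document; each statement's English description precedes it below -/
import Mathlib

section
/- Let p ≥ 5 be a prime, d = p^n - 3, and for b ∈ F = GF(p^n) let N(b) be the number of x ∈ F with (x+1)^d - x^d = b. Let ω₂ be the number of b ∈ F with N(b) = 2, and set λ₁ := ∑_{x ∈ F} η((x²-4)(-3x²-4)). Then 4·ω₂ = p^n - 5 - λ₁ - η(-3) + 2η(-1) + c, where c = 8 if p = 7 and n is odd, c = -8 if η(2) = 1 and η(-7) = -1, and c = 0 otherwise. -/
open Finset

section CharacterSums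

variable {F : Type*} [Field F] [Fintype F] [DecidableEq F]

/-- The number of roots of a monic quadratic polynomial over a finite field of odd
characteristic. -/
lemma card_roots_monic_quadratic (h2 : (2 : F) ≠ 0) (s t : F) :
    ((univ.filter fun x : F => x ^ 2 - s * x + t = 0).card : ℤ)
      = quadraticChar F (s ^ 2 - 4 * t) + 1 := by
  have hc : ringChar F ≠ 2 := fun h => h2 (by
    have := ringChar.Nat.cast_ringChar (R := F)
    rw [h] at this
    exact_mod_cast this)
  rw [← quadraticChar_card_sqrts hc]
  norm_cast
  refine card_bij (fun x _ => 2 * x - s) ?_ ?_ ?_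
  · intro x hx
    simp only [mem_filter, mem_univ, true_and, Set.mem_toFinset, Set.mem_ofPred_eq] at hx ⊢
    linear_combination 4 * hx
  · intro x _ y _ h
    exact mul_left_cancel₀ h2 (by linear_combination h)
  · intro y hy
    simp only [Set.mem_toFinset, Set.mem_ofPred_eq] at hy
    refine ⟨(y + s) / 2, ?_, by field_simp; ring⟩
    simp only [mem_filter, mem_univ, true_and]
    field_simp
    linear_combination hy

/-- Summation over the fibres of `x ↦ x + b / x`. -/
lemma sum_comp_add_div (h2 : (2 : F) ≠ 0) {b : F} (hb : b ≠ 0) (h : F → ℤ) :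
    ∑ x ∈ univ.erase (0 : F), h (x + b / x)
      = ∑ m : F, (quadraticChar F (m ^ 2 - 4 * b) + 1) * h m := by
  rw [← sum_fiberwise_of_maps_to (t := univ) (g := fun x : F => x + b / x)
    (fun _ _ => mem_univ _)]
  refine sum_congr rfl fun m _ => ?_
  rw [sum_congr rfl (g := fun _ => h m) (fun x hx => by rw [(mem_filter.mp hx).2]),
    sum_const, nsmul_eq_mul, ← card_roots_monic_quadratic h2 m b]
  congr 3
  ext x
  simp only [mem_filter, mem_univ, true_and, mem_erase, and_true]
  constructor
  · rintro ⟨hx, h⟩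
    field_simp at h
    linear_combination h
  · intro h
    have hx : x ≠ 0 := by
      rintro rfl
      exact hb (by linear_combination h)
    refine ⟨hx, ?_⟩
    field_simp
    linear_combination h

lemma sum_quadraticChar_sq_sub (h2 : (2 : F) ≠ 0) {b : F} (hb : b ≠ 0) :
    ∑ m : F, quadraticChar F (m ^ 2 - 4 * b) = -1 := by
  have h := sum_comp_add_div h2 hb (fun _ => 1)
  simp only [sum_const, card_erase_of_mem (mem_univ _), mul_one, sum_add_distrib, card_univ,
    nsmul_eq_mul] at h
  rw [Nat.cast_sub Fintype.card_pos] at h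
  push_cast at h
  linarith

lemma quadraticChar_mul_sq (a : F) {c : F} (hc : c ≠ 0) :
    quadraticChar F (a * c ^ 2) = quadraticChar F a := by
  rw [map_mul, quadraticChar_sq_one' hc, mul_one]

lemma sum_quadraticChar_neg_three_mul_sq_sub_four (h2 : (2 : F) ≠ 0) (h3 : (3 : F) ≠ 0) :
    ∑ v : F, quadraticChar F (-3 * v ^ 2 - 4) = -quadraticChar F (-3) := by
  have hb : (-1 / 3 : F) ≠ 0 := by simp [h3]
  have h := sum_quadraticChar_sq_sub h2 hb
  calc ∑ v : F, quadraticChar F (-3 * v ^ 2 - 4)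
      = ∑ v : F, quadraticChar F (-3) * quadraticChar F (v ^ 2 - 4 * (-1 / 3)) := by
        refine sum_congr rfl fun v _ => ?_
        rw [← map_mul]
        congr 1
        field_simp
        ring
    _ = -quadraticChar F (-3) := by rw [← mul_sum, h]; ring

lemma sum_quadraticChar_palindromic (h2 : (2 : F) ≠ 0) (h3 : (3 : F) ≠ 0) :
    ∑ u ∈ univ.erase (0 : F), quadraticChar F (-(3 * u ^ 2 + 1) * (u ^ 2 + 3))
      = ∑ x : F, quadraticChar F ((x ^ 2 - 4) * (-3 * x ^ 2 - 4)) - quadraticChar F (-3) := by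
  have h := sum_comp_add_div h2 (one_ne_zero (α := F))
    (fun v => quadraticChar F (-3 * v ^ 2 - 4))
  have e : ∀ u ∈ univ.erase (0 : F), quadraticChar F (-(3 * u ^ 2 + 1) * (u ^ 2 + 3))
      = quadraticChar F (-3 * (u + 1 / u) ^ 2 - 4) := by
    intro u hu
    have hu0 : u ≠ 0 := (mem_erase.mp hu).1
    rw [← quadraticChar_mul_sq (-3 * (u + 1 / u) ^ 2 - 4) hu0]
    congr 1
    field_simp
    ring
  rw [sum_congr rfl e, h]
  simp only [add_mul, one_mul, sum_add_distrib, mul_one, ← map_mul]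
  rw [sum_quadraticChar_neg_three_mul_sq_sub_four h2 h3]
  ring

lemma card_sq_eq (h2 : (2 : F) ≠ 0) (a : F) :
    ((univ.filter fun x : F => x ^ 2 = a).card : ℤ) = quadraticChar F a + 1 := by
  have h := card_roots_monic_quadratic h2 0 (-a)
  have e : (0 : F) ^ 2 - 4 * -a = a * 2 ^ 2 := by ring
  rw [e, quadraticChar_mul_sq a h2] at h
  rw [← h]
  congr 3
  ext x
  rw [zero_mul, sub_zero, add_neg_eq_zero]

lemma quadraticChar_sq_eq_ite (a : F) :
    quadraticChar F a ^ 2 = if a = 0 then 0 else 1 := by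
  split_ifs with h
  · simp [h]
  · exact quadraticChar_sq_one h

lemma sum_quadraticChar_sq_mul_sq (h2 : (2 : F) ≠ 0) (h3 : (3 : F) ≠ 0) :
    ∑ u : F, quadraticChar F ((1 - u ^ 2) * (1 + 3 * u ^ 2)) ^ 2
        * quadraticChar F ((u ^ 2 - 1) * (u ^ 2 + 3)) ^ 2
      = Fintype.card F - 4 - 2 * quadraticChar F (-3) := by
  have h4 : (4 : F) ≠ 0 := by
    have := mul_ne_zero h2 h2
    norm_num at this ⊢
    exact this
  have key : ∀ u : F, quadraticChar F ((1 - u ^ 2) * (1 + 3 * u ^ 2)) ^ 2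
        * quadraticChar F ((u ^ 2 - 1) * (u ^ 2 + 3)) ^ 2
      = 1 - (if u ^ 2 = 1 then 1 else 0) - (if u ^ 2 = -3 then 1 else 0)
        - (if u ^ 2 = -1 / 3 then 1 else 0) := by
    intro u
    generalize u ^ 2 = w
    have e1 : w = -1 / 3 ↔ 1 + 3 * w = 0 := by
      field_simp
      constructor <;> intro h <;> linear_combination h
    rw [quadraticChar_sq_eq_ite, quadraticChar_sq_eq_ite]
    simp only [e1]
    by_cases a1 : w = 1
    · subst a1
      have : (1 : F) ≠ -3 := fun h => h4 (by linear_combination h)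
      have h' : (1 + 3 : F) ≠ 0 := fun h => h4 (by linear_combination h)
      simp [this, h']
    · have b1 : 1 - w ≠ 0 := fun h => a1 (by linear_combination -h)
      have b2 : w - 1 ≠ 0 := fun h => a1 (by linear_combination h)
      by_cases a2 : w = -3
      · subst a2
        have : (1 + 3 * -3 : F) ≠ 0 := fun h => mul_ne_zero h2 h4 (by linear_combination -h)
        rw [if_neg this]
        simp [a1]
      · have b3 : w + 3 ≠ 0 := fun h => a2 (by linear_combination h)
        by_cases a3 : 1 + 3 * w = 0 <;> simp [a1, a2, a3, b1, b2, b3]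
  have e3 : quadraticChar F (-1 / 3) = quadraticChar F (-3) := by
    rw [← quadraticChar_mul_sq (-1 / 3) h3]
    congr 1
    field_simp
  rw [sum_congr rfl fun u _ => key u]
  simp only [sum_sub_distrib, sum_boole, sum_const, card_univ, nsmul_eq_mul, mul_one]
  rw [card_sq_eq h2, card_sq_eq h2, card_sq_eq h2, e3, map_one]
  ring

lemma sum_quadraticChar_mul (h2 : (2 : F) ≠ 0) (h3 : (3 : F) ≠ 0) :
    ∑ u ∈ univ.erase (0 : F), quadraticChar F ((1 - u ^ 2) * (1 + 3 * u ^ 2))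
        * quadraticChar F ((u ^ 2 - 1) * (u ^ 2 + 3))
      = ∑ x : F, quadraticChar F ((x ^ 2 - 4) * (-3 * x ^ 2 - 4)) - quadraticChar F (-3)
        - 2 * quadraticChar F (-1) := by
  have h4 : (4 : F) ≠ 0 := by
    have := mul_ne_zero h2 h2
    norm_num at this ⊢
    exact this
  have key : ∀ u ∈ univ.erase (0 : F), quadraticChar F ((1 - u ^ 2) * (1 + 3 * u ^ 2))
        * quadraticChar F ((u ^ 2 - 1) * (u ^ 2 + 3))
      = quadraticChar F (-(3 * u ^ 2 + 1) * (u ^ 2 + 3))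
        - (if u ^ 2 = 1 then 1 else 0) * quadraticChar F (-1) := by
    intro u _
    rw [← map_mul]
    split_ifs with h
    · have e : -(3 * u ^ 2 + 1) * (u ^ 2 + 3) = -1 * 4 ^ 2 := by rw [h]; ring
      rw [e, quadraticChar_mul_sq _ h4, h]
      simp
    · have b : u ^ 2 - 1 ≠ 0 := fun h' => h (by linear_combination h')
      rw [← quadraticChar_mul_sq (-(3 * u ^ 2 + 1) * (u ^ 2 + 3)) b, zero_mul, sub_zero]
      congr 1
      ring
  have hc : ∑ u ∈ univ.erase (0 : F), (if u ^ 2 = 1 then (1 : ℤ) else 0) = 2 := by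
    rw [sum_erase _ (by simp), sum_boole, card_sq_eq h2, map_one]
    rfl
  rw [sum_congr rfl key, sum_sub_distrib, ← sum_mul, hc, sum_quadraticChar_palindromic h2 h3]

lemma four_mul_card_mixed (h2 : (2 : F) ≠ 0) (h3 : (3 : F) ≠ 0) :
    4 * (((univ.erase (0 : F)).filter fun u =>
        quadraticChar F ((1 - u ^ 2) * (1 + 3 * u ^ 2)) = 1 ∧
        quadraticChar F ((u ^ 2 - 1) * (u ^ 2 + 3)) = -1).card : ℤ)
      = Fintype.card F - 5 - ∑ x : F, quadraticChar F ((x ^ 2 - 4) * (-3 * x ^ 2 - 4))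
        - quadraticChar F (-3) + 2 * quadraticChar F (-1) := by
  set f : F → ℤ := fun u => quadraticChar F ((1 - u ^ 2) * (1 + 3 * u ^ 2)) with hf
  set g : F → ℤ := fun u => quadraticChar F ((u ^ 2 - 1) * (u ^ 2 + 3)) with hg
  have tri : ∀ a : F, quadraticChar F a = 0 ∨ quadraticChar F a = 1 ∨ quadraticChar F a = -1 :=
    fun a => by
      by_cases h : a = 0
      · exact Or.inl (by simp [h])
      · exact Or.inr (quadraticChar_dichotomy h)
  have key : ∀ u : F, 4 * (if f u = 1 ∧ g u = -1 then (1 : ℤ) else 0)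
      = f u ^ 2 * g u ^ 2 - f u * g u + (f u * g u ^ 2 - f u ^ 2 * g u) := by
    intro u
    have hfu : f u = 0 ∨ f u = 1 ∨ f u = -1 := tri _
    have hgu : g u = 0 ∨ g u = 1 ∨ g u = -1 := tri _
    rcases hfu with h | h | h <;> rcases hgu with h' | h' | h' <;> simp [h, h']
  have inv : ∀ u ∈ univ.erase (0 : F), g u⁻¹ = f u ∧ f u⁻¹ = g u := by
    intro u hu
    have hu0 : u ≠ 0 := (mem_erase.mp hu).1
    have hu2 : u ^ 2 ≠ 0 := pow_ne_zero 2 hu0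
    constructor
    · simp only [hf, hg]
      rw [← quadraticChar_mul_sq ((u⁻¹ ^ 2 - 1) * (u⁻¹ ^ 2 + 3)) hu2]
      congr 1
      field_simp
    · simp only [hf, hg]
      rw [← quadraticChar_mul_sq ((1 - u⁻¹ ^ 2) * (1 + 3 * u⁻¹ ^ 2)) hu2]
      congr 1
      field_simp
  have anti : ∑ u ∈ univ.erase (0 : F), f u * g u ^ 2
      = ∑ u ∈ univ.erase (0 : F), f u ^ 2 * g u := by
    refine sum_nbij' (fun u => u⁻¹) (fun u => u⁻¹) ?_ ?_ ?_ ?_ ?_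
    · intro u hu; simpa using hu
    · intro u hu; simpa using hu
    · intro u _; simp
    · intro u _; simp
    · intro u hu
      rw [(inv u hu).1, (inv u hu).2]
      ring
  have h0 : f 0 ^ 2 * g 0 ^ 2 = 1 := by
    have : quadraticChar F (-3) ^ 2 = 1 := quadraticChar_sq_one (neg_ne_zero.mpr h3)
    simpa [hf, hg] using this
  have sq := sum_quadraticChar_sq_mul_sq h2 h3
  rw [← add_sum_erase univ _ (mem_univ (0 : F))] at sq
  change f 0 ^ 2 * g 0 ^ 2 + ∑ u ∈ univ.erase (0 : F), f u ^ 2 * g u ^ 2 = _ at sq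
  have pr := sum_quadraticChar_mul h2 h3
  change ∑ u ∈ univ.erase (0 : F), f u * g u = _ at pr
  rw [← sum_boole, mul_sum, sum_congr rfl fun u _ => key u, sum_add_distrib, sum_sub_distrib,
    sum_sub_distrib, anti, pr]
  linarith

end CharacterSums

lemma add_eq_and_mul_eq_of_roots {F : Type*} [Field F] {s t y z : F} (hyz : y ≠ z)
    (hy : y ^ 2 - s * y + t = 0)
    (hz : z ^ 2 - s * z + t = 0) : y + z = s ∧ y * z = t := by
  have h : y + z = s := by
    refine mul_left_cancel₀ (sub_ne_zero.mpr hyz) ?_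
    linear_combination hy - hz
  exact ⟨h, by linear_combination y * h - hy⟩

section Quartic

variable {F : Type*} [Field F] [Fintype F] [DecidableEq F]

/-- The roots of `b (y² - 1)² + 16 y`. -/
def quarticRoots (b : F) : Finset F :=
  univ.filter fun y : F => b * (y ^ 2 - 1) ^ 2 + 16 * y = 0

lemma mem_quarticRoots {b y : F} :
    y ∈ quarticRoots b ↔ b * (y ^ 2 - 1) ^ 2 + 16 * y = 0 := by
  simp [quarticRoots]

lemma mem_quarticRoots_iff_of_factor {b u : F} (hb : b ≠ 0) (hu : u ≠ 0)
    (h : b * ((u ^ 2 + 1) ^ 2 * (u ^ 2 - 1)) = 16 * u ^ 3) (y : F) :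
    y ∈ quarticRoots b ↔
      y ^ 2 - (u + 1 / u) * y + u ^ 2 = 0 ∨ y ^ 2 - -(u + 1 / u) * y + 1 / u ^ 2 = 0 := by
  have e : b * (y ^ 2 - 1) ^ 2 + 16 * y
      = b * ((y ^ 2 - (u + 1 / u) * y + u ^ 2) * (y ^ 2 - -(u + 1 / u) * y + 1 / u ^ 2)) := by
    field_simp
    linear_combination -y * h
  rw [mem_quarticRoots, e, mul_eq_zero, mul_eq_zero, or_iff_right hb]

/-- If the quadratic `Y² - (u + 1/u) Y + u²` splits with simple roots and its cofactor
`Y² + (u + 1/u) Y + 1/u²` is irreducible, the quartic has exactly two roots. -/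
lemma quarticRoots_of_mixed (h2 : (2 : F) ≠ 0) {b u : F} (hb : b ≠ 0) (hu : u ≠ 0)
    (h : b * ((u ^ 2 + 1) ^ 2 * (u ^ 2 - 1)) = 16 * u ^ 3)
    (h₁ : quadraticChar F ((1 - u ^ 2) * (1 + 3 * u ^ 2)) = 1)
    (h₂ : quadraticChar F ((u ^ 2 - 1) * (u ^ 2 + 3)) = -1) :
    (quarticRoots b).card = 2 ∧ quarticRoots b
      = univ.filter fun y : F => y ^ 2 - (u + 1 / u) * y + u ^ 2 = 0 := by
  have c₁ := card_roots_monic_quadratic h2 (u + 1 / u) (u ^ 2)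
  have c₂ := card_roots_monic_quadratic h2 (-(u + 1 / u)) (1 / u ^ 2)
  have e₁ : quadraticChar F ((u + 1 / u) ^ 2 - 4 * u ^ 2) = 1 := by
    rw [← h₁, ← quadraticChar_mul_sq ((u + 1 / u) ^ 2 - 4 * u ^ 2) hu]
    congr 1
    field_simp
    ring
  have e₂ : quadraticChar F ((-(u + 1 / u)) ^ 2 - 4 * (1 / u ^ 2)) = -1 := by
    rw [← h₂, ← quadraticChar_mul_sq ((-(u + 1 / u)) ^ 2 - 4 * (1 / u ^ 2)) hu]
    congr 1
    field_simp
    ring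
  rw [e₁] at c₁
  rw [e₂] at c₂
  norm_num at c₂
  have e : quarticRoots b = univ.filter fun y : F => y ^ 2 - (u + 1 / u) * y + u ^ 2 = 0 := by
    ext y
    rw [mem_quarticRoots_iff_of_factor hb hu h, mem_filter, or_iff_left]
    · simp
    · have := c₂ (x := y)
      simpa using this
  refine ⟨?_, e⟩
  rw [e]
  exact_mod_cast c₁

lemma exists_mixed_of_card_eq_two (h2 : (2 : F) ≠ 0) (h3 : (3 : F) ≠ 0) {b : F}
    (h : (quarticRoots b).card = 2) :
    ∃ u : F, u ≠ 0 ∧ b * ((u ^ 2 + 1) ^ 2 * (u ^ 2 - 1)) = 16 * u ^ 3 ∧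
      quadraticChar F ((1 - u ^ 2) * (1 + 3 * u ^ 2)) = 1 ∧
      quadraticChar F ((u ^ 2 - 1) * (u ^ 2 + 3)) = -1 := by
  have h4 : (4 : F) ≠ 0 := by
    have := mul_ne_zero h2 h2
    norm_num at this ⊢
    exact this
  have h16 : (16 : F) ≠ 0 := by
    have := mul_ne_zero h4 h4
    norm_num at this ⊢
    exact this
  obtain ⟨y, z, hyz, hroots⟩ := card_eq_two.mp h
  have hmem : ∀ x, b * (x ^ 2 - 1) ^ 2 + 16 * x = 0 ↔ x = y ∨ x = z := fun x => by
    rw [← mem_quarticRoots, hroots, mem_insert, mem_singleton]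
  have hy := (hmem y).2 (Or.inl rfl)
  have hz := (hmem z).2 (Or.inr rfl)
  have hsub : y - z ≠ 0 := sub_ne_zero.mpr hyz
  have hb : b ≠ 0 := by
    rintro rfl
    refine hyz (mul_left_cancel₀ h16 ?_)
    linear_combination hy - hz
  have hy0 : y ≠ 0 := by
    rintro rfl
    exact hb (by linear_combination hy)
  have hz0 : z ≠ 0 := by
    rintro rfl
    exact hb (by linear_combination hz)
  have rel : y * z * (y + z) ^ 2 = (y * z + 1) ^ 2 := by
    refine mul_left_cancel₀ (mul_ne_zero hb hsub) ?_
    linear_combination z * hy - y * hz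
  have hs : y + z ≠ 0 := by
    intro h0
    have hz' : z = -y := by linear_combination h0
    subst hz'
    have hsq : y ^ 2 - 1 = 0 := by
      have : (y ^ 2 - 1) ^ 2 = 0 := by linear_combination -rel
      exact pow_eq_zero_iff (two_ne_zero) |>.mp this
    rw [hsq] at hy
    exact mul_ne_zero h16 hy0 (by linear_combination hy)
  obtain ⟨u, hu⟩ : ∃ u, u = (y * z + 1) / (y + z) := ⟨_, rfl⟩
  have hus : u * (y + z) = y * z + 1 := by rw [hu]; field_simp
  have hut : u ^ 2 = y * z := by
    refine mul_right_cancel₀ (pow_ne_zero 2 hs) ?_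
    linear_combination (u * (y + z) + y * z + 1) * hus - rel
  have hu0 : u ≠ 0 := by
    rintro rfl
    exact mul_ne_zero hy0 hz0 (by linear_combination -hut)
  have hsum : y + z = u + 1 / u := by
    field_simp
    linear_combination hus - hut
  have hbu : b * ((u ^ 2 + 1) ^ 2 * (u ^ 2 - 1)) = 16 * u ^ 3 := by
    have hquad : y ^ 2 - (u + 1 / u) * y + u ^ 2 = 0 := by rw [← hsum, hut]; ring
    have e : (b * (y ^ 2 - 1) ^ 2 + 16 * y) * u ^ 3
        - y * (16 * u ^ 3 - b * ((u ^ 2 + 1) ^ 2 * (u ^ 2 - 1)))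
      = b * u ^ 3 * ((y ^ 2 - (u + 1 / u) * y + u ^ 2)
          * (y ^ 2 - -(u + 1 / u) * y + 1 / u ^ 2)) := by
      field_simp
      ring
    rw [hy, hquad] at e
    refine mul_left_cancel₀ hy0 ?_
    linear_combination e
  have hroot := mem_quarticRoots_iff_of_factor hb hu0 hbu
  refine ⟨u, hu0, hbu, ?_, ?_⟩
  · have e : (1 - u ^ 2) * (1 + 3 * u ^ 2) = (u * (y - z)) ^ 2 := by
      have hs' : u ^ 2 + 1 = u * (y + z) := by linear_combination hut - hus
      linear_combination (u * (y + z) + u ^ 2 + 1) * hs' - 4 * u ^ 2 * hut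
    rw [e]
    exact quadraticChar_sq_one' (mul_ne_zero hu0 hsub)
  · rw [quadraticChar_neg_one_iff_not_isSquare]
    rintro ⟨w, hw⟩
    have hdouble : ∀ y z : F, u * (y + z) = y * z + 1 → u ^ 2 = y * z →
        y ^ 2 - -(y + z) * y + 1 / u ^ 2 = 0 → 2 * y = -(y + z) → False := by
      intro y z hus hut h₁ hyz
      obtain rfl : z = -3 * y := by linear_combination hyz
      field_simp at h₁
      have hyu : y ^ 2 * u ^ 2 = 1 := by linear_combination -h₁
      have hy4 : -3 * y ^ 4 = 1 := by linear_combination hyu - y ^ 2 * hut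
      have hy2 : y ^ 2 = -1 := by
        refine mul_left_cancel₀ (mul_ne_zero h2 h3) ?_
        linear_combination (u * (y + -3 * y) + y * (-3 * y) + 1) * hus - 4 * hyu - 3 * hy4
      exact h4 (by linear_combination -hy4 - 3 * (y ^ 2 - 1) * hy2)
    have hv : ∀ v, v ^ 2 - -(y + z) * v + 1 / u ^ 2 = 0 → v = y ∨ v = z := fun v hv => by
      rw [← hmem, ← mem_quarticRoots, hroot, ← hsum]
      exact Or.inr hv
    have hdisc : (w / u) ^ 2 = (y + z) ^ 2 - 4 * (1 / u ^ 2) := by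
      rw [hsum]
      field_simp
      linear_combination -hw
    have hr : ∀ δ : F, δ ^ 2 = (y + z) ^ 2 - 4 * (1 / u ^ 2) →
        ((-(y + z) + δ) / 2) ^ 2 - -(y + z) * ((-(y + z) + δ) / 2) + 1 / u ^ 2 = 0 := by
      intro δ hδ
      generalize 1 / u ^ 2 = c at hδ ⊢
      field_simp
      linear_combination hδ
    have r₁ := hr (w / u) hdisc
    have r₂ := hr (-(w / u)) (by rw [neg_sq, hdisc])
    have hadd : (-(y + z) + w / u) / 2 + (-(y + z) + -(w / u)) / 2 = -(y + z) := by
      field_simp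
      ring
    have hmixed : y + z = -(y + z) → False := fun h =>
      mul_ne_zero h2 hs (by linear_combination h)
    rcases hv _ r₁ with h | h <;> rcases hv _ r₂ with h' | h' <;> rw [h, h'] at hadd
    · exact hdouble y z hus hut (by rw [h] at r₁; exact r₁)
        (by linear_combination hadd)
    · exact hmixed hadd
    · exact hmixed (by linear_combination hadd)
    · exact hdouble z y (by linear_combination hus) (by linear_combination hut)
        (by rw [h] at r₁; linear_combination r₁) (by linear_combination hadd)

/-- The number of `b` for which the quartic has exactly two roots. -/
lemma card_filter_card_quarticRoots_eq_two (h2 : (2 : F) ≠ 0) (h3 : (3 : F) ≠ 0) :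
    (univ.filter fun b : F => (quarticRoots b).card = 2).card
      = ((univ.erase (0 : F)).filter fun u =>
        quadraticChar F ((1 - u ^ 2) * (1 + 3 * u ^ 2)) = 1 ∧
        quadraticChar F ((u ^ 2 - 1) * (u ^ 2 + 3)) = -1).card := by
  have h16 : (16 : F) ≠ 0 := by
    have := pow_ne_zero 4 h2
    norm_num at this ⊢
    exact this
  have hne : ∀ u : F, quadraticChar F ((1 - u ^ 2) * (1 + 3 * u ^ 2)) = 1 →
      quadraticChar F ((u ^ 2 - 1) * (u ^ 2 + 3)) = -1 →
      (u ^ 2 + 1) ^ 2 * (u ^ 2 - 1) ≠ 0 := by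
    intro u h₁ h₂ h
    rcases mul_eq_zero.mp h with h | h
    · have hu : u ^ 2 = -1 := by
        have := pow_eq_zero_iff (two_ne_zero) |>.mp h
        linear_combination this
      rw [hu] at h₁ h₂
      have e : (1 - -1 : F) * (1 + 3 * -1) = (-1 - 1) * (-1 + 3) := by ring
      rw [e, h₂] at h₁
      norm_num at h₁
    · rw [h, zero_mul, MulChar.map_zero] at h₂
      norm_num at h₂
  have hbne : ∀ u : F, u ≠ 0 → ∀ b : F,
      b * ((u ^ 2 + 1) ^ 2 * (u ^ 2 - 1)) = 16 * u ^ 3 → b ≠ 0 := by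
    rintro u hu b h rfl
    rw [zero_mul] at h
    exact mul_ne_zero h16 (pow_ne_zero 3 hu) h.symm
  symm
  refine card_bij (fun u _ => 16 * u ^ 3 / ((u ^ 2 + 1) ^ 2 * (u ^ 2 - 1))) ?_ ?_ ?_
  · intro u hu
    simp only [mem_filter, mem_erase, mem_univ, and_true, true_and] at hu ⊢
    obtain ⟨hu0, h₁, h₂⟩ := hu
    have h := div_mul_cancel₀ (16 * u ^ 3) (hne u h₁ h₂)
    exact (quarticRoots_of_mixed h2 (hbne u hu0 _ h) hu0 h h₁ h₂).1
  · intro u hu v hv huv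
    simp only [mem_filter, mem_erase, mem_univ, and_true] at hu hv
    obtain ⟨hu0, hu₁, hu₂⟩ := hu
    obtain ⟨hv0, hv₁, hv₂⟩ := hv
    have hu' := div_mul_cancel₀ (16 * u ^ 3) (hne u hu₁ hu₂)
    have hv' := div_mul_cancel₀ (16 * v ^ 3) (hne v hv₁ hv₂)
    rw [← huv] at hv'
    obtain ⟨hc, hru⟩ := quarticRoots_of_mixed h2 (hbne u hu0 _ hu') hu0 hu' hu₁ hu₂
    obtain ⟨-, hrv⟩ := quarticRoots_of_mixed h2 (hbne v hv0 _ hv') hv0 hv' hv₁ hv₂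
    obtain ⟨y, z, hyz, hroots⟩ := card_eq_two.mp hc
    have hmem : ∀ x ∈ ({y, z} : Finset F), x ^ 2 - (u + 1 / u) * x + u ^ 2 = 0 ∧
        x ^ 2 - (v + 1 / v) * x + v ^ 2 = 0 := by
      intro x hx
      rw [← hroots] at hx
      exact ⟨by rw [hru] at hx; exact (mem_filter.mp hx).2,
        by rw [hrv] at hx; exact (mem_filter.mp hx).2⟩
    obtain ⟨hyu, hyv⟩ := hmem y (by simp)
    obtain ⟨hzu, hzv⟩ := hmem z (by simp)
    obtain ⟨su, pu⟩ := add_eq_and_mul_eq_of_roots hyz hyu hzu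
    obtain ⟨sv, pv⟩ := add_eq_and_mul_eq_of_roots hyz hyv hzv
    have hs : u * (y + z) = v * (y + z) := by
      have eu : u * (y + z) = u ^ 2 + 1 := by rw [su]; field_simp
      have ev : v * (y + z) = v ^ 2 + 1 := by rw [sv]; field_simp
      linear_combination eu - ev - pu + pv
    refine mul_right_cancel₀ ?_ hs
    intro h0
    refine hne u hu₁ hu₂ ?_
    have : u ^ 2 + 1 = 0 := by
      rw [su] at h0
      field_simp at h0
      rwa [mul_zero] at h0
    rw [this]
    ring
  · intro b hb
    obtain ⟨u, hu0, hbu, h₁, h₂⟩ :=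
      exists_mixed_of_card_eq_two h2 h3 (mem_filter.mp hb).2
    refine ⟨u, mem_filter.mpr ⟨mem_erase.mpr ⟨hu0, mem_univ _⟩, h₁, h₂⟩, ?_⟩
    rw [div_eq_iff (hne u h₁ h₂), hbu]

end Quartic

section Special

variable {F : Type*} [Field F] [Fintype F] [DecidableEq F]

lemma card_quarticRoots_neg (b : F) : (quarticRoots (-b)).card = (quarticRoots b).card := by
  refine card_nbij' (fun y => -y) (fun y => -y) ?_ ?_ ?_ ?_
  · intro y hy
    simp only [mem_coe, mem_quarticRoots] at hy ⊢
    linear_combination -hy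
  · intro y hy
    simp only [mem_coe, mem_quarticRoots] at hy ⊢
    linear_combination -hy
  · intro y _; simp
  · intro y _; simp

lemma card_quarticRoots_one_of_not_isSquare (h2 : (2 : F) ≠ 0) (h : ¬ IsSquare (2 : F)) :
    (quarticRoots (1 : F)).card = 0 := by
  rw [card_eq_zero, eq_empty_iff_forall_notMem]
  intro y hy
  rw [mem_quarticRoots] at hy
  by_cases hy1 : y = 1
  · subst hy1
    exact pow_ne_zero 4 h2 (by linear_combination hy)
  · have hy' : y - 1 ≠ 0 := sub_ne_zero.mpr hy1
    refine h ⟨(y ^ 2 + 3) / (2 * (y - 1)), ?_⟩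
    field_simp
    linear_combination -hy

lemma card_quarticRoots_one_of_sq (h2 : (2 : F) ≠ 0) {r : F} (hr : r ^ 2 = 2) :
    ((quarticRoots (1 : F)).card : ℤ)
      = 2 + quadraticChar F (-1 - 2 * r) + quadraticChar F (-1 + 2 * r) := by
  have hr0 : r ≠ 0 := by
    rintro rfl
    exact h2 (by linear_combination -hr)
  have h4 : (4 : F) ≠ 0 := by
    have := pow_ne_zero 2 h2
    norm_num at this ⊢
    exact this
  have c₁ := card_roots_monic_quadratic h2 (2 * r) (3 + 2 * r)
  have c₂ := card_roots_monic_quadratic h2 (-(2 * r)) (3 - 2 * r)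
  have e₁ : (2 * r) ^ 2 - 4 * (3 + 2 * r) = (-1 - 2 * r) * 2 ^ 2 := by
    linear_combination 4 * hr
  have e₂ : (-(2 * r)) ^ 2 - 4 * (3 - 2 * r) = (-1 + 2 * r) * 2 ^ 2 := by
    linear_combination 4 * hr
  rw [e₁, quadraticChar_mul_sq _ h2] at c₁
  rw [e₂, quadraticChar_mul_sq _ h2] at c₂
  have hunion : quarticRoots (1 : F)
      = (univ.filter fun y : F => y ^ 2 - 2 * r * y + (3 + 2 * r) = 0)
        ∪ univ.filter fun y : F => y ^ 2 - -(2 * r) * y + (3 - 2 * r) = 0 := by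
    ext y
    have e : 1 * (y ^ 2 - 1) ^ 2 + 16 * y
        = (y ^ 2 - 2 * r * y + (3 + 2 * r)) * (y ^ 2 - -(2 * r) * y + (3 - 2 * r)) := by
      linear_combination 4 * (y - 1) ^ 2 * hr
    rw [mem_quarticRoots, e, mul_eq_zero]
    simp
  have hdisj : Disjoint (univ.filter fun y : F => y ^ 2 - 2 * r * y + (3 + 2 * r) = 0)
      (univ.filter fun y : F => y ^ 2 - -(2 * r) * y + (3 - 2 * r) = 0) := by
    rw [disjoint_filter]
    intro y _ h₁ h₂
    have hy : y = 1 := mul_left_cancel₀ (mul_ne_zero h4 hr0) (by linear_combination h₂ - h₁)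
    subst hy
    exact h4 (by linear_combination h₁)
  rw [hunion, card_union_of_disjoint hdisj]
  push_cast
  linarith

lemma card_quarticRoots_one_of_seven (h2 : (2 : F) ≠ 0) (h7 : (7 : F) = 0) :
    ((quarticRoots (1 : F)).card : ℤ) = 2 + quadraticChar F (-1) := by
  have hr : (3 : F) ^ 2 = 2 := by linear_combination h7
  have e₁ : (-1 - 2 * 3 : F) = 0 := by linear_combination -h7
  have e₂ : (-1 + 2 * 3 : F) = -1 * 3 ^ 2 := by linear_combination 2 * h7
  have h3 : (3 : F) ≠ 0 := by
    intro h
    rw [h] at hr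
    exact h2 (by linear_combination -hr)
  rw [card_quarticRoots_one_of_sq h2 hr, e₁, e₂, quadraticChar_mul_sq _ h3, MulChar.map_zero,
    add_zero]

lemma card_quarticRoots_one_of_ne (h2 : (2 : F) ≠ 0) (h7 : (7 : F) ≠ 0) :
    (quarticRoots (1 : F)).card ≠ 1 ∧
      ((quarticRoots (1 : F)).card = 2 ↔
        quadraticChar F 2 = 1 ∧ quadraticChar F (-7) = -1) := by
  by_cases hsq : IsSquare (2 : F)
  · obtain ⟨r, hr⟩ := hsq
    have hr' : r ^ 2 = 2 := by rw [hr]; ring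
    have hc := card_quarticRoots_one_of_sq h2 hr'
    have hprod : (-1 - 2 * r) * (-1 + 2 * r) = -7 := by linear_combination -4 * hr'
    have hne : (-1 - 2 * r) * (-1 + 2 * r) ≠ 0 := hprod ▸ neg_ne_zero.mpr h7
    have hη2 : quadraticChar F 2 = 1 := (quadraticChar_one_iff_isSquare h2).mpr ⟨r, hr⟩
    rw [← hprod, map_mul, hη2]
    rcases quadraticChar_dichotomy (left_ne_zero_of_mul hne) with h | h <;>
    rcases quadraticChar_dichotomy (right_ne_zero_of_mul hne) with h' | h' <;>
    rw [h, h'] at hc ⊢ <;> constructor <;> omega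
  · rw [card_quarticRoots_one_of_not_isSquare h2 hsq,
      quadraticChar_neg_one_iff_not_isSquare.mpr hsq]
    norm_num

end Special

section Differential

variable {F : Type*} [Field F] [Fintype F] [DecidableEq F]

lemma card_differential_eq (h2 : (2 : F) ≠ 0) (hq : 5 ≤ Fintype.card F)
    (heven : Even (Fintype.card F - 3)) (b : F) :
    (univ.filter fun x : F =>
        (x + 1) ^ (Fintype.card F - 3) - x ^ (Fintype.card F - 3) = b).card
      = (quarticRoots b).card + (if b = 1 then 1 else 0) + (if b = -1 then 1 else 0) := by
  set d := Fintype.card F - 3 with hd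
  have hd0 : d ≠ 0 := by omega
  have h16 : (16 : F) ≠ 0 := by
    have := pow_ne_zero 4 h2
    norm_num at this ⊢
    exact this
  have h11 : (1 : F) ≠ -1 := fun h => h2 (by linear_combination h)
  have hpow : ∀ x : F, x ≠ 0 → x ^ d * x ^ 2 = 1 := fun x hx => by
    rw [← pow_add, show d + 2 = Fintype.card F - 1 by omega]
    exact FiniteField.pow_card_sub_one_eq_one x hx
  have key : ∀ x : F, (x + 1) ^ d - x ^ d = b ↔
      2 * x + 1 ∈ quarticRoots b ∨ (2 * x + 1 = 1 ∧ b = 1) ∨ (2 * x + 1 = -1 ∧ b = -1) := by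
    intro x
    rw [mem_quarticRoots]
    by_cases hx : x = 0
    · subst hx
      have : ¬ (b * ((2 * 0 + 1) ^ 2 - 1) ^ 2 + 16 * (2 * 0 + 1) = 0) := fun h =>
        h16 (by linear_combination h)
      simp [hd0, h11, h16, eq_comm]
    by_cases hx1 : x = -1
    · subst hx1
      have e : (2 * -1 + 1 : F) = -1 := by ring
      rw [e]
      simp [hd0, h11.symm, h16, heven.neg_one_pow, eq_comm (a := b)]
    have hx1' : x + 1 ≠ 0 := fun h => hx1 (by linear_combination h)
    have n1 : 2 * x + 1 ≠ 1 := fun h => mul_ne_zero h2 hx (by linear_combination h)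
    have n2 : 2 * x + 1 ≠ -1 := fun h => mul_ne_zero h2 hx1' (by linear_combination h)
    simp only [n1, n2, false_and, or_false]
    have p₁ := hpow x hx
    have p₂ := hpow (x + 1) hx1'
    have e : b * ((2 * x + 1) ^ 2 - 1) ^ 2 + 16 * (2 * x + 1)
        = 16 * (x ^ 2 * (x + 1) ^ 2) * (b - ((x + 1) ^ d - x ^ d)) := by
      linear_combination 16 * x ^ 2 * p₂ - 16 * (x + 1) ^ 2 * p₁
    rw [e, mul_eq_zero, or_iff_right (mul_ne_zero h16
      (mul_ne_zero (pow_ne_zero 2 hx) (pow_ne_zero 2 hx1'))), sub_eq_zero, eq_comm]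
  have hbij : (univ.filter fun x : F => (x + 1) ^ d - x ^ d = b).card
      = (univ.filter fun y : F =>
          y ∈ quarticRoots b ∨ (y = 1 ∧ b = 1) ∨ (y = -1 ∧ b = -1)).card := by
    refine card_nbij' (fun x => 2 * x + 1) (fun y => (y - 1) / 2) ?_ ?_ ?_ ?_
    · intro x hx
      simpa only [coe_filter, mem_univ, true_and, Set.mem_ofPred_eq, key] using hx
    · intro y hy
      have e : 2 * ((y - 1) / 2) + 1 = y := by field_simp; ring
      simpa only [coe_filter, mem_univ, true_and, Set.mem_ofPred_eq, key, e] using hy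
    · intro x _
      field_simp
      ring
    · intro y _
      field_simp
      ring
  have nm : ∀ y, (y = 1 ∨ y = -1) → y ∉ quarticRoots b := by
    intro y hy h
    rw [mem_quarticRoots] at h
    rcases hy with rfl | rfl
    · exact h16 (by linear_combination h)
    · exact h16 (by linear_combination -h)
  rw [hbij]
  by_cases hb1 : b = 1
  · have e : (univ.filter fun y : F => y ∈ quarticRoots b ∨ (y = 1 ∧ b = 1) ∨ (y = -1 ∧ b = -1))
        = insert 1 (quarticRoots b) := by
      ext y
      simp [hb1, h11, or_comm]
    rw [e, card_insert_of_notMem (nm 1 (Or.inl rfl))]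
    simp [hb1, h11]
  by_cases hb2 : b = -1
  · have e : (univ.filter fun y : F => y ∈ quarticRoots b ∨ (y = 1 ∧ b = 1) ∨ (y = -1 ∧ b = -1))
        = insert (-1) (quarticRoots b) := by
      ext y
      simp [hb2, h11.symm, or_comm]
    rw [e, card_insert_of_notMem (nm (-1) (Or.inr rfl))]
    simp [hb2, h11.symm]
  · simp [hb1, hb2]

lemma card_differential_two (h2 : (2 : F) ≠ 0) (hq : 5 ≤ Fintype.card F)
    (heven : Even (Fintype.card F - 3)) :
    ((univ.filter fun b : F => (univ.filter fun x : F =>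
        (x + 1) ^ (Fintype.card F - 3) - x ^ (Fintype.card F - 3) = b).card = 2).card : ℤ)
      = (univ.filter fun b : F => (quarticRoots b).card = 2).card
        + 2 * ((if (quarticRoots (1 : F)).card = 1 then 1 else 0)
          - (if (quarticRoots (1 : F)).card = 2 then 1 else 0)) := by
  have h11 : (1 : F) ≠ -1 := fun h => h2 (by linear_combination h)
  set c : ℤ := (if (quarticRoots (1 : F)).card = 1 then 1 else 0)
    - (if (quarticRoots (1 : F)).card = 2 then 1 else 0) with hc
  rw [← sum_boole, ← sum_boole]
  have key : ∀ b : F, (if (univ.filter fun x : F =>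
        (x + 1) ^ (Fintype.card F - 3) - x ^ (Fintype.card F - 3) = b).card = 2 then (1 : ℤ) else 0)
      = (if (quarticRoots b).card = 2 then 1 else 0) + (if b = 1 then c else 0)
        + (if b = -1 then c else 0) := by
    intro b
    rw [card_differential_eq h2 hq heven]
    by_cases hb1 : b = 1
    · subst hb1
      simp [h11, hc]
    by_cases hb2 : b = -1
    · subst hb2
      rw [card_quarticRoots_neg]
      simp [h11.symm, hc]
    · simp [hb1, hb2]
  rw [sum_congr rfl fun b _ => key b, sum_add_distrib, sum_add_distrib, sum_ite_eq' univ,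
    sum_ite_eq' univ, if_pos (mem_univ _), if_pos (mem_univ _)]
  ring

end Differential

/-- For a prime `p ≥ 5`, `d = p^n - 3`, `N(b) = #{x ∈ F : (x+1)^d - x^d = b}`,
`ω₂ = #{b ∈ F : N(b) = 2}` and `λ₁ = ∑_{x ∈ F} η((x²-4)(-3x²-4))`:
`4ω₂ = p^n - 5 - λ₁ - η(-3) + 2η(-1) + c`, where `c = 8` if `p = 7` and `n`
is odd, `c = -8` if `η(2) = 1` and `η(-7) = -1`, and `c = 0` otherwise. -/
theorem stmt_17 (p n : ℕ) (hp : p.Prime) (hp5 : 5 ≤ p) (hn : 0 < n)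
    (F : Type*) [Field F] [Fintype F] [DecidableEq F]
    (hF : Fintype.card F = p ^ n)
    (η : F → ℤ)
    (hη0 : η 0 = 0)
    (hη1 : ∀ x : F, x ≠ 0 → IsSquare x → η x = 1)
    (hη2 : ∀ x : F, ¬ IsSquare x → η x = -1) :
    4 * ((Finset.univ.filter (fun b : F =>
        (Finset.univ.filter
          (fun x : F => (x + 1) ^ (p ^ n - 3) - x ^ (p ^ n - 3) = b)).card = 2)).card : ℤ) =
      (p : ℤ) ^ n - 5 - (∑ x : F, η ((x ^ 2 - 4) * (-3 * x ^ 2 - 4)))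
        - η (-3) + 2 * η (-1)
        + (if p = 7 ∧ Odd n then (8 : ℤ)
           else if η 2 = 1 ∧ η (-7) = -1 then (-8 : ℤ) else 0) := by
  have hη : ∀ x, η x = quadraticChar F x := by
    intro x
    by_cases h0 : x = 0
    · rw [h0, hη0, MulChar.map_zero]
    by_cases hx : IsSquare x
    · rw [hη1 x h0 hx, (quadraticChar_one_iff_isSquare h0).mpr hx]
    · rw [hη2 x hx, quadraticChar_neg_one_iff_not_isSquare.mpr hx]
  have : Fact p.Prime := ⟨hp⟩
  have hchar : CharP F p := charP_of_card_eq_prime_pow hF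
  have hprime : ∀ m : ℕ, m.Prime → m ≠ p → (m : F) ≠ 0 := fun m hm hmp h =>
    hmp ((Nat.prime_dvd_prime_iff_eq hp hm).mp ((CharP.cast_eq_zero_iff F p m).mp h)).symm
  have h2 : (2 : F) ≠ 0 := by exact_mod_cast hprime 2 Nat.prime_two (by omega)
  have h3 : (3 : F) ≠ 0 := by exact_mod_cast hprime 3 Nat.prime_three (by omega)
  have hq : 5 ≤ Fintype.card F := hF ▸ hp5.trans (Nat.le_self_pow hn.ne' p)
  have hodd : Odd (Fintype.card F) := by
    rw [hF]
    exact (hp.odd_of_ne_two (by omega)).pow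
  have heven : Even (Fintype.card F - 3) := by
    obtain ⟨k, hk⟩ := hodd
    exact ⟨k - 1, by omega⟩
  have main := card_differential_two h2 hq heven
  have count := four_mul_card_mixed (F := F) h2 h3
  rw [← card_filter_card_quarticRoots_eq_two h2 h3] at count
  simp only [hη]
  simp only [hF] at main
  rw [hF] at count
  push_cast at count
  have corr : 8 * ((if (quarticRoots (1 : F)).card = 1 then (1 : ℤ) else 0)
        - (if (quarticRoots (1 : F)).card = 2 then 1 else 0))
      = if p = 7 ∧ Odd n then (8 : ℤ)
        else if quadraticChar F 2 = 1 ∧ quadraticChar F (-7) = -1 then (-8 : ℤ) else 0 := by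
    by_cases hp7 : p = 7
    · have h7 : (7 : F) = 0 := by
        have := CharP.cast_eq_zero F p
        rw [hp7] at this
        exact_mod_cast this
      have hc := card_quarticRoots_one_of_seven h2 h7
      rw [h7, neg_zero, MulChar.map_zero]
      have hmod : Fintype.card F % 4 = if Odd n then 3 else 1 := by
        rw [hF, hp7]
        split_ifs with h
        · obtain ⟨k, rfl⟩ := h
          rw [pow_succ, pow_mul, Nat.mul_mod, Nat.pow_mod]
          norm_num
        · obtain ⟨k, rfl⟩ := Nat.not_odd_iff_even.mp h
          rw [← two_mul, pow_mul, Nat.pow_mod]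
          norm_num
      by_cases hn' : Odd n
      · have hη : quadraticChar F (-1) = -1 := by
          rw [quadraticChar_neg_one_iff_not_isSquare, FiniteField.isSquare_neg_one_iff, hmod,
            if_pos hn']
          simp
        have hc1 : (quarticRoots (1 : F)).card = 1 := by omega
        simp [hc1, hp7, hn']
      · have hη : quadraticChar F (-1) = 1 := by
          rw [quadraticChar_one_iff_isSquare (neg_ne_zero.mpr one_ne_zero),
            FiniteField.isSquare_neg_one_iff, hmod, if_neg hn']
          simp
        have hc3 : (quarticRoots (1 : F)).card = 3 := by omega
        simp [hc3, hn']
    · have h7 : (7 : F) ≠ 0 := by exact_mod_cast hprime 7 (by norm_num) (Ne.symm hp7)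
      obtain ⟨hc1, hc2⟩ := card_quarticRoots_one_of_ne h2 h7
      have hpn : ¬(p = 7 ∧ Odd n) := fun h => hp7 h.1
      rw [if_neg hc1, if_neg hpn]
      by_cases h : quadraticChar F 2 = 1 ∧ quadraticChar F (-7) = -1
      · rw [if_pos (hc2.mpr h), if_pos h]
        norm_num
      · rw [if_neg (mt hc2.mp h), if_neg h]
        norm_num
  rw [main]
  linarith
end

section
/- Let d = p^n - 3 with p^n > 3, for b ∈ F = GF(p^n) let N(b) = #{x ∈ F : (x+1)^d - x^d = b}, and for 0 ≤ i ≤ 5 let ω_i = #{b ∈ F : N(b) = i}. Let M be the number of (x₁,x₂,x₃,x₄) ∈ F⁴ with x₁ - x₂ + x₃ - x₄ = 0 and x₁^d - x₂^d + x₃^d - x₄^d = 0. Then: 4(p^n - 1)·ω₀ = M - 2p^{2n} + p^n + (p^n - 1)(2ω₂ + 2ω₃ - 4ω₅); 3(p^n - 1)·ω₁ = -M + 5p^{2n} - 4p^n - (p^n - 1)(4ω₂ + 3ω₃ - 5ω₅); and 12(p^n - 1)·ω₄ = M - 2p^{2n} + p^n - (p^n - 1)(2ω₂ + 6ω₃ +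 20ω₅). -/
open Polynomial in
/-- The map `x ↦ x ^ (q - 3)` on a field with `q > 3` elements, `q` odd, is
differentially 5-uniform. -/
theorem card_filter_derivative_pow_card_sub_three_le_five {F : Type*} [Field F] [Fintype F]
    [DecidableEq F] (hq : 3 < Fintype.card F) (hchar : ringChar F ≠ 2) (b : F) :
    (Finset.univ.filter (fun x : F =>
      (x + 1) ^ (Fintype.card F - 3) - x ^ (Fintype.card F - 3) = b)).card ≤ 5 := by
  set d := Fintype.card F - 3 with hd
  have hd0 : d ≠ 0 := by omega
  have hpow (x : F) (hx : x ≠ 0) : x ^ d * x ^ 2 = 1 := by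
    rw [← pow_add, ← FiniteField.pow_card_sub_one_eq_one x hx]
    congr 1
    omega
  have hneg : (-1 : F) ^ d = 1 := by
    have h := hpow (-1) (by simp)
    simpa using h
  have hne : (-1 : F) ≠ 1 := Ring.neg_one_ne_one_of_char_ne_two hchar
  let P : F[X] := C b * X ^ 2 * (X + 1) ^ 2 + 2 * X + 1
  have hP : P ≠ 0 := by
    intro h
    have : P.eval 0 = 0 := by rw [h, eval_zero]
    simp [P] at this
  have hdeg : P.natDegree ≤ 4 := by
    simp only [P]
    compute_degree
  have hsub : Finset.univ.filter (fun x : F => (x + 1) ^ d - x ^ d = b) ⊆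
      insert (if b = 1 then 0 else -1) P.roots.toFinset := by
    intro x hx
    simp only [Finset.mem_filter, Finset.mem_univ, true_and] at hx
    simp only [Finset.mem_insert, Multiset.mem_toFinset, mem_roots hP]
    by_cases h0 : x = 0
    · subst h0
      left
      rw [if_pos]
      simpa [hd0] using hx.symm
    by_cases h1 : x = -1
    · subst h1
      left
      rw [if_neg]
      have hb : -1 = b := by simpa [hd0, hneg] using hx
      exact hb ▸ hne
    right
    have h1' : x + 1 ≠ 0 := fun h => h1 (eq_neg_of_add_eq_zero_left h)
    have e0 := hpow x h0
    have e1 := hpow (x + 1) h1'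
    simp only [P, IsRoot.def, eval_add, eval_mul, eval_C, eval_pow, eval_X, eval_one,
      eval_ofNat]
    linear_combination (-x ^ 2 * (x + 1) ^ 2) * hx + x ^ 2 * e1 - (x + 1) ^ 2 * e0
  calc _ ≤ _ := Finset.card_le_card hsub
    _ ≤ P.roots.toFinset.card + 1 := Finset.card_insert_le _ _
    _ ≤ 4 + 1 := by
      gcongr
      exact (Multiset.toFinset_card_le _).trans ((card_roots' P).trans hdeg)

theorem Finset.card_filter_apply_eq_apply {α β : Type*} [Fintype α] [Fintype β] [DecidableEq β]
    (g : α → β) :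
    (Finset.univ.filter (fun t : α × α => g t.1 = g t.2)).card =
      ∑ b, (Finset.univ.filter (fun x => g x = b)).card ^ 2 := by
  classical
  rw [Finset.card_eq_sum_card_fiberwise (f := fun t => g t.1) (t := Finset.univ) (by simp)]
  refine Finset.sum_congr rfl fun b _ => ?_
  rw [sq, ← Finset.card_product]
  congr 1
  ext ⟨x, y⟩
  simp only [Finset.mem_filter, Finset.mem_univ, true_and, Finset.mem_product]
  constructor
  · rintro ⟨h, rfl⟩
    exact ⟨rfl, h.symm⟩
  · rintro ⟨rfl, h⟩
    exact ⟨h.symm, rfl⟩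

/-- The fourth moment of a power map in terms of the squared fibre sizes of its derivative. -/
theorem card_filter_quadruples_pow {F : Type*} [Field F] [Fintype F] [DecidableEq F] (d : ℕ) :
    (Finset.univ.filter (fun t : F × F × F × F => t.1 - t.2.1 + t.2.2.1 - t.2.2.2 = 0 ∧
        t.1 ^ d - t.2.1 ^ d + t.2.2.1 ^ d - t.2.2.2 ^ d = 0)).card =
      Fintype.card F ^ 2 + (Fintype.card F - 1) *
        ∑ b : F, (Finset.univ.filter (fun x : F => (x + 1) ^ d - x ^ d = b)).card ^ 2 := by
  rw [Finset.card_eq_sum_card_fiberwise (f := fun t => t.1 - t.2.1) (t := Finset.univ) (by simp),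
    ← Finset.add_sum_erase _ _ (Finset.mem_univ (0 : F))]
  congr 1
  · rw [sq, ← Fintype.card_prod, ← Finset.card_univ]
    refine Finset.card_nbij' (fun t => (t.1, t.2.2.1)) (fun s => (s.1, s.1, s.2, s.2))
      ?_ ?_ ?_ ?_
    · simp
    · rintro ⟨y, z⟩ -
      simp
    · rintro ⟨x₁, x₂, x₃, x₄⟩ h
      simp only [Finset.coe_filter, Finset.mem_filter, Finset.mem_univ, true_and,
        Set.mem_ofPred_eq] at h
      obtain ⟨⟨h, -⟩, h₀⟩ := h
      simp only [Prod.mk.injEq, true_and]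
      exact ⟨by linear_combination h₀, by linear_combination h - h₀⟩
    · rintro ⟨y, z⟩ -
      rfl
  · rw [← Finset.card_univ, ← Finset.card_erase_of_mem (Finset.mem_univ (0 : F)), ← smul_eq_mul]
    refine Finset.sum_eq_card_nsmul fun a ha => ?_
    have ha : a ≠ 0 := Finset.ne_of_mem_erase ha
    rw [← Finset.card_filter_apply_eq_apply (fun x : F => (x + 1) ^ d - x ^ d)]
    refine Finset.card_nbij' (fun t => (t.2.1 / a, t.2.2.1 / a))
      (fun s => (a * (s.1 + 1), a * s.1, a * s.2, a * (s.2 + 1))) ?_ ?_ ?_ ?_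
    · rintro ⟨x₁, x₂, x₃, x₄⟩ h
      simp only [Finset.coe_filter, Finset.mem_filter, Finset.mem_univ, true_and,
        Set.mem_ofPred_eq] at h ⊢
      obtain ⟨⟨h, h'⟩, h₀⟩ := h
      have e₁ : x₂ / a + 1 = x₁ / a := by
        field_simp
        linear_combination -h₀
      have e₄ : x₃ / a + 1 = x₄ / a := by
        field_simp
        linear_combination h - h₀
      rw [e₁, e₄]
      simp only [div_pow]
      linear_combination h' / a ^ d
    · rintro ⟨y, z⟩ h
      simp only [Finset.coe_filter, Finset.mem_filter, Finset.mem_univ, true_and,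
        Set.mem_ofPred_eq] at h ⊢
      simp only [mul_pow]
      exact ⟨⟨by ring, by linear_combination a ^ d * h⟩, by ring⟩
    · rintro ⟨x₁, x₂, x₃, x₄⟩ h
      simp only [Finset.coe_filter, Finset.mem_filter, Finset.mem_univ, true_and,
        Set.mem_ofPred_eq] at h
      obtain ⟨⟨h, -⟩, h₀⟩ := h
      simp only [Prod.mk.injEq, mul_add, mul_div_cancel₀ _ ha, mul_one, true_and]
      exact ⟨by linear_combination -h₀, by linear_combination h - h₀⟩
    · rintro ⟨y, z⟩ -
      simp [ha]


/-- With `d = p^n - 3`, `p^n > 3`, `N(b) = #{x ∈ F : (x+1)^d - x^d = b}`,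
`ω_i = #{b ∈ F : N(b) = i}` and `M` the number of quadruples
`(x₁,x₂,x₃,x₄) ∈ F⁴` with `x₁ - x₂ + x₃ - x₄ = 0` and
`x₁^d - x₂^d + x₃^d - x₄^d = 0`:
`4(p^n - 1)ω₀ = M - 2p^{2n} + p^n + (p^n - 1)(2ω₂ + 2ω₃ - 4ω₅)`,
`3(p^n - 1)ω₁ = -M + 5p^{2n} - 4p^n - (p^n - 1)(4ω₂ + 3ω₃ - 5ω₅)`, and
`12(p^n - 1)ω₄ = M - 2p^{2n} + p^n - (p^n - 1)(2ω₂ + 6ω₃ + 20ω₅)`. -/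
theorem stmt_18 (p n : ℕ) (hp : p.Prime) (hp2 : p ≠ 2) (hn : 0 < n)
    (F : Type*) [Field F] [Fintype F] [DecidableEq F]
    (hF : Fintype.card F = p ^ n)
    (hq : 3 < p ^ n)
    (N : F → ℕ)
    (hN : ∀ b : F, N b = (Finset.univ.filter
      (fun x : F => (x + 1) ^ (p ^ n - 3) - x ^ (p ^ n - 3) = b)).card)
    (ω : ℕ → ℕ)
    (hω : ∀ i : ℕ, ω i = (Finset.univ.filter (fun b : F => N b = i)).card)
    (M : ℕ)
    (hM : M = (Finset.univ.filter
      (fun t : F × F × F × F => t.1 - t.2.1 + t.2.2.1 - t.2.2.2 = 0 ∧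
        t.1 ^ (p ^ n - 3) - t.2.1 ^ (p ^ n - 3) + t.2.2.1 ^ (p ^ n - 3)
          - t.2.2.2 ^ (p ^ n - 3) = 0)).card) :
    4 * ((p : ℤ) ^ n - 1) * (ω 0 : ℤ) =
      (M : ℤ) - 2 * (p : ℤ) ^ (2 * n) + (p : ℤ) ^ n
        + ((p : ℤ) ^ n - 1) * (2 * (ω 2 : ℤ) + 2 * (ω 3 : ℤ) - 4 * (ω 5 : ℤ)) ∧
    3 * ((p : ℤ) ^ n - 1) * (ω 1 : ℤ) =
      -(M : ℤ) + 5 * (p : ℤ) ^ (2 * n) - 4 * (p : ℤ) ^ n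
        - ((p : ℤ) ^ n - 1) * (4 * (ω 2 : ℤ) + 3 * (ω 3 : ℤ) - 5 * (ω 5 : ℤ)) ∧
    12 * ((p : ℤ) ^ n - 1) * (ω 4 : ℤ) =
      (M : ℤ) - 2 * (p : ℤ) ^ (2 * n) + (p : ℤ) ^ n
        - ((p : ℤ) ^ n - 1) * (2 * (ω 2 : ℤ) + 6 * (ω 3 : ℤ) + 20 * (ω 5 : ℤ)) := by
  have hodd : p ^ n % 2 = 1 := Nat.odd_iff.mp ((hp.odd_of_ne_two hp2).pow)
  have hchar : ringChar F ≠ 2 := fun h => by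
    have := FiniteField.even_card_iff_char_two.mp h
    omega
  have hN5 (b : F) : N b ∈ Finset.range 6 := by
    have h := card_filter_derivative_pow_card_sub_three_le_five (hF ▸ hq) hchar b
    rw [hF, ← hN] at h
    exact Finset.mem_range.mpr (by omega)
  have hsum (h : ℕ → ℕ) : ∑ b, h (N b) = ∑ i ∈ Finset.range 6, ω i * h i := by
    rw [← Finset.sum_fiberwise_of_maps_to (g := N) (fun b _ => hN5 b)]
    refine Finset.sum_congr rfl fun i _ => ?_
    rw [hω, ← smul_eq_mul]
    exact Finset.sum_eq_card_nsmul fun b hb => by rw [(Finset.mem_filter.mp hb).2]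
  have h₀ : p ^ n = ∑ i ∈ Finset.range 6, ω i * 1 := by
    rw [← hsum (fun _ => 1), ← hF]
    simp
  have h₁ : p ^ n = ∑ i ∈ Finset.range 6, ω i * i := by
    rw [← hsum (fun i => i), ← hF, ← Finset.card_univ]
    simp only [hN]
    exact Finset.card_eq_sum_card_fiberwise (by simp)
  have h₂ : M = (p ^ n) ^ 2 + (p ^ n - 1) * ∑ i ∈ Finset.range 6, ω i * i ^ 2 := by
    rw [← hsum (fun i => i ^ 2), hM, card_filter_quadruples_pow, hF]
    simp only [hN]
  simp only [Finset.sum_range_succ, Finset.sum_range_zero] at h₀ h₁ h₂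
  zify [show 1 ≤ p ^ n by omega] at h₀ h₁ h₂
  rw [mul_comm 2 n, pow_mul]
  generalize (p : ℤ) ^ n = q at h₀ h₁ h₂ ⊢
  refine ⟨?_, ?_, ?_⟩
  · linear_combination -h₂ + (-4 * (q - 1)) * h₀ + 5 * (q - 1) * h₁
  · linear_combination h₂ - 4 * (q - 1) * h₁
  · linear_combination -h₂ + (q - 1) * h₁
end

section
/- Let p = 3, n ≥ 2, d = 3^n - 3, and for b ∈ F = GF(3^n) let N(b) = #{x ∈ F : (x+1)^d - x^d = b} and ω_i = #{b ∈ F : N(b) = i} for 0 ≤ i ≤ 5. Then: (i) if n is odd, (ω₀, ω₁, ω₂, ω₃, ω₄, ω₅) = ((3^n-3)/2, 3, (3^n-3)/2, 0, 0, 0); (ii) if n ≡ 2 (mod 4), (ω₀, ω₁, ω₂, ω₃, ω₄, ω₅) = ((3^n-9)/4, 2·3^{n-1}+3, 0, 0, (3^{n-1}-3)/4, 0); (iii) if n ≡ 0 (mod 4), (ω₀, ω₁, ω₂, ω₃, ω₄, ω₅) = ((3^n-1)/4, 2·3^{n-1}+1, 0, 0, (3^{n-1}-11)/4, 2). -/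
section Spectrum

open Finset

section CharThree
variable {F : Type*} [Field F] [CharP F 3]

theorem collision_iff {y z : F} (hyz : z ≠ y) :
    z * (y ^ 2 - 1) ^ 2 = y * (z ^ 2 - 1) ^ 2 ↔ y * z * ((y - z) ^ 2 + 1) = 1 := by
  have : z - y ≠ 0 := sub_ne_zero.2 hyz
  have key : z * (y ^ 2 - 1) ^ 2 - y * (z ^ 2 - 1) ^ 2 =
    (z - y) * (1 - y * z * ((y - z) ^ 2 + 1)) := by grind
  rw [← sub_eq_zero, key, mul_eq_zero, or_iff_right this, sub_eq_zero, eq_comm]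

theorem collision_of_param {y u : F} (hu : u ^ 3 + u = y⁻¹) (hy : y ≠ 0) :
    y * (u ^ 4 * y) * ((y - u ^ 4 * y) ^ 2 + 1) = 1 := by
  have : y * (u ^ 3 + u) = 1 := by rw [hu]; field_simp
  grind

theorem den_ne_zero {y z : F} (hy : y ≠ 0) (hy1 : y ^ 2 ≠ 1)
    (h : y * z * ((y - z) ^ 2 + 1) = 1) : y ^ 2 + 1 - y * z ≠ 0 := by
  intro hD
  have : (y ^ 2 - 1) ^ 2 = 0 := by grind
  grind

theorem param_eq {y u : F} (hu : u ^ 3 + u = y⁻¹) (hy : y ≠ 0) :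
    u * (y ^ 2 + 1 - y * (u ^ 4 * y)) = y + u ^ 4 * y := by
  have : y * (u ^ 3 + u) = 1 := by rw [hu]; field_simp
  grind

theorem param_spec {y z : F} (hy : y ≠ 0) (hD : y ^ 2 + 1 - y * z ≠ 0)
    (h : y * z * ((y - z) ^ 2 + 1) = 1) :
    ((y + z) / (y ^ 2 + 1 - y * z)) ^ 3 + (y + z) / (y ^ 2 + 1 - y * z) = y⁻¹ ∧
    ((y + z) / (y ^ 2 + 1 - y * z)) ^ 4 * y = z := by
  constructor
  · field_simp
    grind
  · field_simp
    grind

theorem ne_of_param {y u : F} (hu : u ^ 3 + u = y⁻¹) (hy : y ≠ 0) (hy1 : y ^ 2 ≠ 1) : 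
    u ^ 4 * y ≠ y := by
  intro h
  have h1 : y * (u ^ 3 + u) = 1 := by rw [hu]; field_simp
  have h4 : (u ^ 2 - 1) * (u ^ 2 + 1) = 0 := by grind
  rcases mul_eq_zero.1 h4 with h | h
  · have : (u-1)*(u+1) = 0 := by grind
    grind
  · grind

theorem quartic_pow {y c : F} (hc : c ^ 2 = 1) (h : (y ^ 2 - 1) ^ 2 = c * y) :
    y ^ 81 = y ∧ y ^ 9 ≠ y := by
  have h4 : y ^ 4 = c * y - y ^ 2 - 1 := by grind
  have h6 : y ^ 6 = c * y ^ 3 - c * y + 1 := by grind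
  have h9 : y ^ 9 = -y ^ 3 + c * y ^ 2 + y - c := by grind
  have h27 : y ^ 27 = -c * y ^ 2 + y + c := by
    have : y ^ 27 = (y ^ 9) ^ 3 := by ring
    rw [this, h9]; grind
  have h81 : y ^ 81 = (y ^ 27) ^ 3 := by ring
  refine ⟨by rw [h81, h27]; grind, fun h => ?_⟩
  have h3 : y ^ 3 = c * y ^ 2 - c := by grind
  have h2 : y * (y - c) = 0 := by grind
  rcases mul_eq_zero.1 h2 with h | h <;> grind

theorem quartic_root {g : F} (hg : g ^ 8 = -1) : ∃ y : F, (y ^ 2 - 1) ^ 2 = y := by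
  have h : (g ^ 2 - (1 - g ^ 4)) * (g ^ 2 + (1 - g ^ 4)) = 0 := by grind
  rcases mul_eq_zero.1 h with h | h
  · exact ⟨-g ^ 4 - g ^ 5, by grind⟩
  · exact ⟨-g ^ 4 - g, by grind⟩

end CharThree

section Counting

theorem mul_card_filter_card_fiber {α β : Type*} [Fintype β] [DecidableEq α] [DecidableEq β]
    (S : Finset α) (G : α → β) (k : ℕ) :
    #{b | #{y ∈ S | G y = b} = k} * k = #{y ∈ S | #{z ∈ S | G z = G y} = k} := by
  rw [card_eq_sum_card_fiberwise (f := G) (t := ({b | #{y ∈ S | G y = b} = k} : Finset β))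
    (fun y hy => by simpa using (mem_filter.1 hy).2), sum_const_nat]
  intro b hb
  rw [filter_filter, ← (mem_filter_univ b).1 hb]
  congr 1
  refine filter_congr fun y _ => ⟨fun h => h.2, fun h => ⟨?_, h⟩⟩
  rw [h]

end Counting

section FiniteFieldThree
variable {F : Type*} [Field F] [Fintype F] [DecidableEq F]

/-- The elements outside the prime field. -/
def outerSet (F : Type*) [Field F] [Fintype F] [DecidableEq F] : Finset F :=
  {y | y ≠ 0 ∧ y ^ 2 ≠ 1}

/-- The derivative `(x + 1)⁻² - x⁻²` in the coordinate `y = x - 1`, for `x` outside the prime field. -/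
def outerMap (y : F) : F := y / (y ^ 2 - 1) ^ 2

theorem mem_outerSet {y : F} : y ∈ outerSet F ↔ y ≠ 0 ∧ y ^ 2 ≠ 1 := by
  simp [outerSet]

theorem outerMap_eq_iff {y z : F} (hy : y ∈ outerSet F) (hz : z ∈ outerSet F) :
    outerMap z = outerMap y ↔ z * (y ^ 2 - 1) ^ 2 = y * (z ^ 2 - 1) ^ 2 := by
  rw [mem_outerSet] at hy hz
  have h1 := sub_ne_zero.2 hy.2
  have h2 := sub_ne_zero.2 hz.2
  rw [outerMap, outerMap, div_eq_div_iff (by positivity) (by positivity)]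

theorem compl_outerSet : (outerSet F)ᶜ = {0, 1, -1} := by
  ext y
  simp [mem_outerSet]
  tauto

theorem exists_of_card_fiber_pos {b : F} (h : #{y ∈ outerSet F | outerMap y = b} ≠ 0) :
    ∃ y ∈ outerSet F, outerMap y = b := by
  obtain ⟨y, hy⟩ := card_pos.1 (Nat.pos_of_ne_zero h)
  exact ⟨y, (mem_filter.1 hy).1, (mem_filter.1 hy).2⟩

theorem card_outerMap_fiber_zero : #{z ∈ outerSet F | outerMap z = 0} = 0 := by
  rw [card_eq_zero, filter_eq_empty_iff]
  intro y hy
  have := mem_outerSet.1 hy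
  simp [outerMap, this, sub_eq_zero]

variable [CharP F 3]

theorem card_fiber_eq {y : F} (hy : y ∈ outerSet F) :
    #{z ∈ outerSet F | outerMap z = outerMap y} = #{u : F | u ^ 3 + u = y⁻¹} + 1 := by
  have hy' := mem_outerSet.1 hy
  obtain ⟨hy0, hy1⟩ := hy'
  have hmem : y ∈ ({z ∈ outerSet F | outerMap z = outerMap y} : Finset F) := by simp [hy]
  rw [← card_erase_add_one hmem, add_left_inj]
  symm
  refine card_bij (fun u _ => u ^ 4 * y) ?_ ?_ ?_
  · intro u hu
    simp only [mem_filter_univ] at hu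
    have hne := ne_of_param hu hy0 hy1
    have hcol := (collision_iff hne).2 (collision_of_param hu hy0)
    have hu0 : u ≠ 0 := by rintro rfl; simp [hy0.symm] at hu
    have hz : u ^ 4 * y ∈ outerSet F := by
      refine mem_outerSet.2 ⟨by positivity, fun h1 => ?_⟩
      rw [h1] at hcol
      have := sub_ne_zero.2 hy1
      have h0 : u ^ 4 * y * (y ^ 2 - 1) ^ 2 ≠ 0 := by positivity
      simp [hcol] at h0
    simp only [mem_erase, mem_filter]
    exact ⟨hne, hz, (outerMap_eq_iff hy hz).2 hcol⟩
  · intro u hu v hv huv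
    simp only [mem_filter_univ] at hu hv huv
    have hD := den_ne_zero hy0 hy1 (collision_of_param hu hy0)
    have hu' := param_eq hu hy0
    have hv' := param_eq hv hy0
    rw [← huv, ← hu'] at hv'
    exact (mul_right_cancel₀ hD hv').symm
  · intro z hz
    simp only [mem_erase, mem_filter] at hz
    obtain ⟨hne, hz, h⟩ := hz
    rw [outerMap_eq_iff hy hz, collision_iff hne] at h
    have := param_spec hy0 (den_ne_zero hy0 hy1 h) h
    exact ⟨_, by simpa using this.1, this.2⟩

omit [Fintype F] in
theorem card_prime_field : #({0, 1, -1} : Finset F) = 3 := by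
  have h : (1 : F) ≠ -1 := by grind
  simp [card_insert_of_notMem, h]

theorem card_outerSet : #(outerSet F) = Fintype.card F - 3 := by
  rw [← compl_compl (outerSet F), card_compl, compl_outerSet, card_prime_field]

theorem card_filter_difference (q : ℕ) (hq : 3 < q) (hF : Fintype.card F = q) (b : F) :
    #{x : F | (x + 1) ^ (q - 3) - x ^ (q - 3) = b} =
      #{y ∈ outerSet F | outerMap y = b} + if b ∈ ({0, 1, -1} : Finset F) then 1 else 0 := by
  have hpow (x : F) : x ^ (q - 3) = (x ^ 2)⁻¹ := by
    rcases eq_or_ne x 0 with rfl | hx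
    · rw [zero_pow (by omega)]; simp
    · have := FiniteField.pow_card_sub_one_eq_one x hx
      rw [hF, show q - 1 = (q - 3) + 2 by omega, pow_add] at this
      exact eq_inv_of_mul_eq_one_left this
  simp only [hpow]
  have hshift : #{x : F | ((x + 1) ^ 2)⁻¹ - (x ^ 2)⁻¹ = b} =
      #{y : F | ((y - 1) ^ 2)⁻¹ - ((y + 1) ^ 2)⁻¹ = b} := by
    refine card_bij' (fun x _ => x - 1) (fun y _ => y + 1) ?_ ?_ ?_ ?_
    · intro x
      simp only [mem_filter_univ]
      rw [show x - 1 - 1 = x + 1 by grind, sub_add_cancel]; exact id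
    · intro x
      simp only [mem_filter_univ]
      rw [show x + 1 + 1 = x - 1 by grind]; exact id
    · simp
    · simp
  rw [hshift, ← card_filter_add_card_filter_not (fun y => y ∈ outerSet F), filter_filter,
    filter_filter]
  congr 1
  · congr 1
    ext y
    simp only [mem_filter, mem_univ, true_and]
    rw [and_comm]
    refine and_congr_right fun hy => ?_
    have hy := mem_outerSet.1 hy
    have h1 : y - 1 ≠ 0 := by grind
    have h2 : y + 1 ≠ 0 := by grind
    have h3 : y ^ 2 - 1 ≠ 0 := sub_ne_zero.2 hy.2
    have : ((y - 1) ^ 2)⁻¹ - ((y + 1) ^ 2)⁻¹ = outerMap y := by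
      rw [outerMap]
      field_simp
      grind
    rw [this]
  · have h (y : F) : y ∉ outerSet F ↔ y ∈ ({0, 1, -1} : Finset F) := by
      rw [← compl_outerSet, mem_compl]
    have h2 : (1 : F) ≠ -1 := by grind
    have e2 : (1 + 1 : F) = -1 := by grind
    have : ({y : F | ((y - 1) ^ 2)⁻¹ - ((y + 1) ^ 2)⁻¹ = b ∧ y ∉ outerSet F} : Finset F) =
        if b ∈ ({0, 1, -1} : Finset F) then {-b} else ∅ := by
      ext y
      simp only [mem_filter_univ, h]
      split_ifs with hb
      · simp only [mem_insert, mem_singleton] at hb ⊢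
        grind
      · simp only [mem_insert, mem_singleton] at hb ⊢
        simp only [notMem_empty, iff_false, not_and]
        grind
    rw [this]
    split_ifs <;> simp

theorem card_cube_add_self_fiber_of_not_isSquare (h : ¬IsSquare (-1 : F)) (w : F) :
    #{u : F | u ^ 3 + u = w} = 1 := by
  have hinj : Function.Injective fun u : F => u ^ 3 + u := by
    intro u v huv
    simp only at huv
    by_contra hne
    have hne := sub_ne_zero.2 hne
    have h0 : (u - v) * ((u - v) ^ 2 + 1) = 0 := by grind
    refine h ⟨u - v, ?_⟩
    rw [← sq, eq_comm]
    exact eq_neg_of_add_eq_zero_left ((mul_eq_zero.1 h0).resolve_left hne)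
  obtain ⟨u, hu⟩ := (Finite.injective_iff_surjective.1 hinj) w
  rw [card_eq_one]
  refine ⟨u, ?_⟩
  ext v
  simp only [mem_filter_univ, mem_singleton, ← hu]
  exact hinj.eq_iff

theorem card_cube_add_self_fiber_of_isSquare (h : IsSquare (-1 : F)) (u : F) :
    #{v : F | v ^ 3 + v = u ^ 3 + u} = 3 := by
  obtain ⟨i, hi⟩ := h
  have hi0 : i ≠ 0 := by rintro rfl; simp at hi
  have : ({v : F | v ^ 3 + v = u ^ 3 + u} : Finset F) = {u, u + i, u - i} := by
    ext v
    simp only [mem_filter_univ, mem_insert, mem_singleton]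
    have key : v ^ 3 + v - (u ^ 3 + u) = (v - u) * (v - (u + i)) * (v - (u - i)) := by grind
    rw [← sub_eq_zero, key, mul_eq_zero, mul_eq_zero, sub_eq_zero, sub_eq_zero, sub_eq_zero,
      or_assoc]
  rw [this]
  have h1 : u ≠ u + i := by grind
  have h2 : u ≠ u - i := by grind
  have h3 : u + i ≠ u - i := by grind
  simp [card_insert_of_notMem, *]

theorem card_image_cube_add_self (h : IsSquare (-1 : F)) :
    #(univ.image fun u : F => u ^ 3 + u) * 3 = Fintype.card F := by
  rw [← card_univ, card_eq_sum_card_image (fun u : F => u ^ 3 + u) univ, sum_const_nat]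
  intro b hb
  obtain ⟨u, -, rfl⟩ := mem_image.1 hb
  exact card_cube_add_self_fiber_of_isSquare h u

theorem card_outerSet_inv_mem_image (h : IsSquare (-1 : F)) :
    #{y ∈ outerSet F | ∃ u : F, u ^ 3 + u = y⁻¹} * 3 = Fintype.card F - 9 := by
  have hsub : ({0, 1, -1} : Finset F) ⊆ univ.image fun u : F => u ^ 3 + u := by
    intro y hy
    simp only [mem_insert, mem_singleton] at hy
    refine mem_image.2 ⟨-y, mem_univ _, ?_⟩
    grind
  have : #{y ∈ outerSet F | ∃ u : F, u ^ 3 + u = y⁻¹} =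
      #((univ.image fun u : F => u ^ 3 + u) \ {0, 1, -1}) := by
    refine card_bij' (fun y _ => y⁻¹) (fun y _ => y⁻¹) ?_ ?_ (by simp) (by simp)
    · intro y hy
      rw [← compl_outerSet]
      simp only [mem_filter, mem_outerSet] at hy
      simpa [mem_outerSet, hy.1] using hy.2
    · intro y hy
      rw [← compl_outerSet] at hy
      simpa [mem_outerSet, and_comm] using hy
  rw [this, card_sdiff_of_subset hsub, card_prime_field, ← card_image_cube_add_self h]
  omega

theorem card_outerMap_fiber_of_not_isSquare (h : ¬IsSquare (-1 : F)) {y : F}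
    (hy : y ∈ outerSet F) : #{z ∈ outerSet F | outerMap z = outerMap y} = 2 := by
  rw [card_fiber_eq hy, card_cube_add_self_fiber_of_not_isSquare h]

theorem card_outerMap_fiber_of_isSquare (h : IsSquare (-1 : F)) {y : F}
    (hy : y ∈ outerSet F) : #{z ∈ outerSet F | outerMap z = outerMap y} =
      if ∃ u : F, u ^ 3 + u = y⁻¹ then 4 else 1 := by
  rw [card_fiber_eq hy]
  split_ifs with hu
  · obtain ⟨u, hu⟩ := hu
    rw [← hu, card_cube_add_self_fiber_of_isSquare h]
  · simpa using hu

theorem outerMap_eq_unit {c y : F} (hc : c ^ 2 = 1) (hy : y ∈ outerSet F) (h : outerMap y = c) :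
    (y ^ 2 - 1) ^ 2 = c * y := by
  have := sub_ne_zero.2 (mem_outerSet.1 hy).2
  rw [outerMap, div_eq_iff (by positivity)] at h
  grind

omit [DecidableEq F] [CharP F 3] in
theorem pow_nine_eq_self {n : ℕ} (hF : Fintype.card F = 3 ^ n) (hn : n % 4 ≠ 0) {y : F}
    (h : y ^ 81 = y) : y ^ 9 = y := by
  have hk (k : ℕ) : y ^ 81 ^ k = y := by
    induction k with
    | zero => simp
    | succ k ih => rw [pow_succ, pow_mul, ih, h]
  have hq := FiniteField.pow_card y
  rw [hF, ← Nat.div_add_mod n 4, pow_add, pow_mul, pow_mul] at hq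
  norm_num only at hq
  rw [hk] at hq
  have : n % 4 < 4 := Nat.mod_lt _ (by norm_num)
  interval_cases hr : n % 4
  · exact absurd rfl hn
  · rw [show y ^ 9 = (y ^ 3) ^ 3 by ring]; simp_all
  · simpa using hq
  · have h3 : y ^ 3 = y := by
      conv_rhs => rw [← h, show y ^ 81 = (y ^ 27) ^ 3 by ring]
      norm_num only at hq
      rw [hq]
    rw [show y ^ 9 = (y ^ 3) ^ 3 by ring, h3, h3]

theorem card_outerMap_fiber_unit_of_mod_four_ne {n : ℕ} (hF : Fintype.card F = 3 ^ n)
    (hn : n % 4 ≠ 0) {c : F} (hc : c ^ 2 = 1) : #{z ∈ outerSet F | outerMap z = c} = 0 := by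
  rw [card_eq_zero, filter_eq_empty_iff]
  intro y hy h
  obtain ⟨h1, h2⟩ := quartic_pow hc (outerMap_eq_unit hc hy h)
  exact h2 (pow_nine_eq_self hF hn h1)

omit [DecidableEq F] in
theorem exists_pow_eight_eq_neg_one {n : ℕ} (hF : Fintype.card F = 3 ^ n) (hn : n % 4 = 0) :
    ∃ g : F, g ^ 8 = -1 := by
  have h2 : ringChar F ≠ 2 := by
    rw [ringChar.eq F 3]; norm_num
  obtain ⟨a, ha⟩ := FiniteField.exists_nonsquare h2
  have ha0 : a ≠ 0 := by rintro rfl; exact ha (by simp)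
  have hpow := (FiniteField.pow_dichotomy h2 ha0).resolve_left
    fun h => ha ((FiniteField.isSquare_iff h2 ha0).2 h)
  have hmod : 3 ^ n % 16 = 1 := by
    rw [← Nat.div_add_mod n 4, hn, add_zero, pow_mul, Nat.pow_mod]
    simp
  refine ⟨a ^ (3 ^ n / 16), ?_⟩
  rw [← pow_mul, ← hpow, hF]
  congr 1
  omega

theorem card_outerMap_fiber_unit_of_mod_four_eq {n : ℕ} (hF : Fintype.card F = 3 ^ n)
    (hn : n % 4 = 0) {c : F} (hc : c ^ 2 = 1) : #{z ∈ outerSet F | outerMap z = c} = 4 := by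
  obtain ⟨g, hg⟩ := exists_pow_eight_eq_neg_one hF hn
  obtain ⟨x, hx⟩ := quartic_root hg
  have hsq : IsSquare (-1 : F) := ⟨g ^ 4, by rw [← hg]; ring⟩
  have hc0 : c ≠ 0 := by rintro rfl; simp at hc
  have mem {y : F} (hy : (y ^ 2 - 1) ^ 2 = c * y) : y ∈ outerSet F ∧ outerMap y = c := by
    have hy0 : y ≠ 0 := by rintro rfl; simp at hy
    have hcy : c * y ≠ 0 := mul_ne_zero hc0 hy0
    have hy1 : y ^ 2 ≠ 1 := fun h => hcy (by rw [← hy, h]; simp)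
    refine ⟨mem_outerSet.2 ⟨hy0, hy1⟩, ?_⟩
    rw [outerMap, hy]
    field_simp
    exact hc.symm
  have hy : ((c * x) ^ 2 - 1) ^ 2 = c * (c * x) := by
    rw [mul_pow, hc, one_mul, hx, ← mul_assoc, ← sq, hc, one_mul]
  have hy3 : (((c * x) ^ 3) ^ 2 - 1) ^ 2 = c * (c * x) ^ 3 := by
    have h3 : c ^ 3 = c := by rw [pow_succ, hc, one_mul]
    calc _ = (((c * x) ^ 2 - 1) ^ 2) ^ 3 := by grind
      _ = _ := by rw [hy, mul_pow c (c * x), h3]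
  have hne : (c * x) ^ 3 ≠ c * x := by
    intro h
    have := (quartic_pow hc hy).2
    rw [show (c * x) ^ 9 = ((c * x) ^ 3) ^ 3 by ring, h] at this
    exact this h
  have h1 : 1 < #{z ∈ outerSet F | outerMap z = c} :=
    one_lt_card.2 ⟨_, mem_filter.2 (mem hy3), _, mem_filter.2 (mem hy), hne⟩
  have h2 := card_outerMap_fiber_of_isSquare hsq (mem hy).1
  rw [(mem hy).2] at h2
  split_ifs at h2 <;> omega

theorem card_filter_add_indicator (M : F → ℕ) {a : ℕ} (h0 : M 0 = 0) (h1 : M 1 = a)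
    (h2 : M (-1) = a) (i : ℕ) :
    #{b | (M b + if b ∈ ({0, 1, -1} : Finset F) then 1 else 0) = i} +
      ((if 0 = i then 1 else 0) + 2 * if a = i then 1 else 0) =
    #{b | M b = i} + ((if 1 = i then 1 else 0) + 2 * if a + 1 = i then 1 else 0) := by
  have h : (1 : F) ≠ -1 := by grind
  rw [← card_filter_add_card_filter_not (s := ({b | M b = i} : Finset F))
      (fun b => b ∈ ({0, 1, -1} : Finset F)),
    ← card_filter_add_card_filter_not
      (s := ({b | (M b + if b ∈ ({0, 1, -1} : Finset F) then 1 else 0) = i} : Finset F))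
      (fun b => b ∈ ({0, 1, -1} : Finset F))]
  simp only [filter_filter]
  have e : #{b | (M b + if b ∈ ({0, 1, -1} : Finset F) then 1 else 0) = i ∧
      b ∉ ({0, 1, -1} : Finset F)} = #{b | M b = i ∧ b ∉ ({0, 1, -1} : Finset F)} := by
    congr 1
    refine filter_congr fun b _ => and_congr_left fun hb => ?_
    rw [if_neg hb, add_zero]
  have small (f : F → ℕ) : #{b | f b = i ∧ b ∈ ({0, 1, -1} : Finset F)} =
      (if f 0 = i then 1 else 0) + (if f 1 = i then 1 else 0) + if f (-1) = i then 1 else 0 := by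
    have : ({b | f b = i ∧ b ∈ ({0, 1, -1} : Finset F)} : Finset F) =
        ({0, 1, -1} : Finset F).filter fun b => f b = i := by
      ext b; simp [and_comm]
    rw [this, card_filter, sum_insert (by simp), sum_insert (by simp [h]), sum_singleton, add_assoc]
  rw [e, small, small]
  simp only [h0, h1, h2, mem_insert, mem_singleton, true_or, or_true, if_true, zero_add]
  omega

theorem card_outerMap_spectrum_of_not_isSquare (h : ¬IsSquare (-1 : F)) :
    #{b : F | #{y ∈ outerSet F | outerMap y = b} = 2} * 2 = Fintype.card F - 3 ∧
    #{b : F | #{y ∈ outerSet F | outerMap y = b} = 0} +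
      #{b : F | #{y ∈ outerSet F | outerMap y = b} = 2} = Fintype.card F ∧
    ∀ k, k ≠ 0 → k ≠ 2 → #{b : F | #{y ∈ outerSet F | outerMap y = b} = k} = 0 := by
  have hval (b : F) : #{y ∈ outerSet F | outerMap y = b} = 0 ∨
      #{y ∈ outerSet F | outerMap y = b} = 2 := by
    refine or_iff_not_imp_left.2 fun hb => ?_
    obtain ⟨y, hy, rfl⟩ := exists_of_card_fiber_pos hb
    exact card_outerMap_fiber_of_not_isSquare h hy
  refine ⟨?_, ?_, fun k hk hk2 => ?_⟩
  · rw [mul_card_filter_card_fiber, ← card_outerSet, filter_true_of_mem]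
    exact fun y hy => card_outerMap_fiber_of_not_isSquare h hy
  · rw [← card_univ, ← card_filter_add_card_filter_not (s := (univ : Finset F))
      (fun b => #{y ∈ outerSet F | outerMap y = b} = 0)]
    congr 2
    refine filter_congr fun b _ => ?_
    have := hval b
    omega
  · rw [card_eq_zero, filter_eq_empty_iff]
    intro b _ hb
    have := hval b
    omega

theorem card_outerMap_spectrum_of_isSquare (h : IsSquare (-1 : F)) :
    #{b : F | #{y ∈ outerSet F | outerMap y = b} = 4} * 4 * 3 = Fintype.card F - 9 ∧
    #{b : F | #{y ∈ outerSet F | outerMap y = b} = 1} +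
      #{b : F | #{y ∈ outerSet F | outerMap y = b} = 4} * 4 = Fintype.card F - 3 ∧
    #{b : F | #{y ∈ outerSet F | outerMap y = b} = 0} +
      (#{b : F | #{y ∈ outerSet F | outerMap y = b} = 1} +
      #{b : F | #{y ∈ outerSet F | outerMap y = b} = 4}) = Fintype.card F ∧
    ∀ k, k ≠ 0 → k ≠ 1 → k ≠ 4 → #{b : F | #{y ∈ outerSet F | outerMap y = b} = k} = 0 := by
  have hval (b : F) : #{y ∈ outerSet F | outerMap y = b} = 0 ∨
      #{y ∈ outerSet F | outerMap y = b} = 1 ∨ #{y ∈ outerSet F | outerMap y = b} = 4 := by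
    refine or_iff_not_imp_left.2 fun hb => ?_
    obtain ⟨y, hy, rfl⟩ := exists_of_card_fiber_pos hb
    have := card_outerMap_fiber_of_isSquare h hy
    split_ifs at this <;> simp [this]
  have h4 : ({y ∈ outerSet F | #{z ∈ outerSet F | outerMap z = outerMap y} = 4} : Finset F) =
      {y ∈ outerSet F | ∃ u : F, u ^ 3 + u = y⁻¹} := by
    refine filter_congr fun y hy => ?_
    rw [card_outerMap_fiber_of_isSquare h hy]
    split_ifs with hu <;> simp [hu]
  have h1 : ({y ∈ outerSet F | #{z ∈ outerSet F | outerMap z = outerMap y} = 1} : Finset F) =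
      {y ∈ outerSet F | ¬∃ u : F, u ^ 3 + u = y⁻¹} := by
    refine filter_congr fun y hy => ?_
    rw [card_outerMap_fiber_of_isSquare h hy]
    split_ifs with hu <;> simp [hu]
  refine ⟨?_, ?_, ?_, fun k hk hk1 hk4 => ?_⟩
  · rw [mul_card_filter_card_fiber, h4, card_outerSet_inv_mem_image h]
  · rw [mul_card_filter_card_fiber, h4, ← mul_one #{b : F | _ = 1}, mul_card_filter_card_fiber, h1,
      add_comm, card_filter_add_card_filter_not, card_outerSet]
  · rw [← card_univ, ← card_filter_add_card_filter_not (s := (univ : Finset F))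
      (fun b => #{y ∈ outerSet F | outerMap y = b} = 0)]
    congr 1
    rw [← card_union_of_disjoint]
    · congr 1
      ext b
      have := hval b
      simp only [mem_union, mem_filter_univ]
      omega
    · refine disjoint_filter.2 fun b _ => ?_
      omega
  · rw [card_eq_zero, filter_eq_empty_iff]
    intro b _ hb
    have := hval b
    omega

omit [DecidableEq F] [CharP F 3] in
theorem isSquare_neg_one_iff_even {n : ℕ} (hF : Fintype.card F = 3 ^ n) :
    IsSquare (-1 : F) ↔ Even n := by
  rw [FiniteField.isSquare_neg_one_iff, hF]
  constructor
  · intro h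
    by_contra hn
    obtain ⟨k, rfl⟩ := Nat.not_even_iff_odd.1 hn
    apply h
    rw [pow_succ, pow_mul, Nat.mul_mod, Nat.pow_mod]
    simp
  · rintro ⟨k, rfl⟩
    rw [← two_mul, pow_mul, Nat.pow_mod]
    simp

end FiniteFieldThree

end Spectrum

/-- The differential spectrum of `x ↦ x^{3^n - 3}` over `F = GF(3^n)`, `n ≥ 2`:
with `d = 3^n - 3`, `N(b) = #{x ∈ F : (x+1)^d - x^d = b}` and
`ω_i = #{b ∈ F : N(b) = i}`,
(i) if `n` is odd, `(ω₀,…,ω₅) = ((3^n-3)/2, 3, (3^n-3)/2, 0, 0, 0)`;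
(ii) if `n ≡ 2 (mod 4)`, `(ω₀,…,ω₅) = ((3^n-9)/4, 2·3^{n-1}+3, 0, 0, (3^{n-1}-3)/4, 0)`;
(iii) if `n ≡ 0 (mod 4)`, `(ω₀,…,ω₅) = ((3^n-1)/4, 2·3^{n-1}+1, 0, 0, (3^{n-1}-11)/4, 2)`. -/
theorem stmt_19 (n : ℕ) (hn : 2 ≤ n)
    (F : Type*) [Field F] [Fintype F] [DecidableEq F]
    (hF : Fintype.card F = 3 ^ n)
    (N : F → ℕ)
    (hN : ∀ b : F, N b = (Finset.univ.filter
      (fun x : F => (x + 1) ^ (3 ^ n - 3) - x ^ (3 ^ n - 3) = b)).card)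
    (ω : ℕ → ℕ)
    (hω : ∀ i : ℕ, ω i = (Finset.univ.filter (fun b : F => N b = i)).card) :
    (Odd n →
      ω 0 = (3 ^ n - 3) / 2 ∧ ω 1 = 3 ∧ ω 2 = (3 ^ n - 3) / 2 ∧
      ω 3 = 0 ∧ ω 4 = 0 ∧ ω 5 = 0) ∧
    (n % 4 = 2 →
      ω 0 = (3 ^ n - 9) / 4 ∧ ω 1 = 2 * 3 ^ (n - 1) + 3 ∧ ω 2 = 0 ∧
      ω 3 = 0 ∧ ω 4 = (3 ^ (n - 1) - 3) / 4 ∧ ω 5 = 0) ∧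
    (n % 4 = 0 →
      ω 0 = (3 ^ n - 1) / 4 ∧ ω 1 = 2 * 3 ^ (n - 1) + 1 ∧ ω 2 = 0 ∧
      ω 3 = 0 ∧ ω 4 = (3 ^ (n - 1) - 11) / 4 ∧ ω 5 = 2) := by
  have : CharP F 3 := by
    have : Fact (Nat.Prime 3) := ⟨Nat.prime_three⟩
    exact charP_of_card_eq_prime_pow (f := n) (by rw [← hF])
  have hQ : 3 ^ n = 3 * 3 ^ (n - 1) := by
    rw [← pow_succ', Nat.sub_add_cancel (by omega)]
  have h3 : 3 ^ 1 ≤ 3 ^ (n - 1) := Nat.pow_le_pow_right (by norm_num) (by omega)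
  have hω' (i : ℕ) : ω i = (Finset.univ.filter fun b : F =>
      (((outerSet F).filter fun y => outerMap y = b).card +
        if b ∈ ({0, 1, -1} : Finset F) then 1 else 0) = i).card := by
    simp only [hω, hN, card_filter_difference (3 ^ n) (by omega) hF]
  have one_sq : (1 : F) ^ 2 = 1 := one_pow 2
  have neg_one_sq : (-1 : F) ^ 2 = 1 := by simp
  refine ⟨fun hn => ?_, fun hn => ?_, fun hn => ?_⟩
  · have hn4 : n % 4 ≠ 0 := by
      have := Nat.odd_iff.1 hn
      omega
    have hsq : ¬IsSquare (-1 : F) := by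
      rwa [isSquare_neg_one_iff_even hF, Nat.not_even_iff_odd]
    have key := card_filter_add_indicator
      (fun b => ((outerSet F).filter fun y => outerMap y = b).card) card_outerMap_fiber_zero
      (card_outerMap_fiber_unit_of_mod_four_ne hF hn4 one_sq)
      (card_outerMap_fiber_unit_of_mod_four_ne hF hn4 neg_one_sq)
    obtain ⟨h2, h0, hk⟩ := card_outerMap_spectrum_of_not_isSquare hsq
    simp only [← hω'] at key
    have k0 := key 0
    have k1 := key 1
    have k2 := key 2
    have k3 := key 3
    have k4 := key 4
    have k5 := key 5
    rw [hF] at h0 h2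
    rw [hk _ (by norm_num) (by norm_num)] at k1 k3 k4 k5
    norm_num only [if_true, if_false] at k0 k1 k2 k3 k4 k5
    omega
  · have hn4 : n % 4 ≠ 0 := by omega
    have hsq : IsSquare (-1 : F) := by
      rw [isSquare_neg_one_iff_even hF, Nat.even_iff]
      omega
    have key := card_filter_add_indicator
      (fun b => ((outerSet F).filter fun y => outerMap y = b).card) card_outerMap_fiber_zero
      (card_outerMap_fiber_unit_of_mod_four_ne hF hn4 one_sq)
      (card_outerMap_fiber_unit_of_mod_four_ne hF hn4 neg_one_sq)
    obtain ⟨h4, h1, h0, hk⟩ := card_outerMap_spectrum_of_isSquare hsq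
    simp only [← hω'] at key
    have k0 := key 0
    have k1 := key 1
    have k2 := key 2
    have k3 := key 3
    have k4 := key 4
    have k5 := key 5
    rw [hF] at h0 h1 h4
    rw [hk _ (by norm_num) (by norm_num) (by norm_num)] at k2 k3 k5
    norm_num only [if_true, if_false] at k0 k1 k2 k3 k4 k5
    omega
  · have hsq : IsSquare (-1 : F) := by
      rw [isSquare_neg_one_iff_even hF, Nat.even_iff]
      omega
    have key := card_filter_add_indicator
      (fun b => ((outerSet F).filter fun y => outerMap y = b).card) card_outerMap_fiber_zero
      (card_outerMap_fiber_unit_of_mod_four_eq hF hn one_sq)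
      (card_outerMap_fiber_unit_of_mod_four_eq hF hn neg_one_sq)
    obtain ⟨h4, h1, h0, hk⟩ := card_outerMap_spectrum_of_isSquare hsq
    simp only [← hω'] at key
    have k0 := key 0
    have k1 := key 1
    have k2 := key 2
    have k3 := key 3
    have k4 := key 4
    have k5 := key 5
    rw [hF] at h0 h1 h4
    rw [hk _ (by norm_num) (by norm_num) (by norm_num)] at k2 k3 k5
    norm_num only [if_true, if_false] at k0 k1 k2 k3 k4 k5
    omega
end
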